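/- Coding theorem: let m be a maximal lower semicomputable semimeasure on binary strings. Then m(x) > 0 for all x, and there exists a constant c such that for all binary strings x: KP(x) ≤ −log₂ m(x) + c and −log₂ m(x) ≤ KP(x) + c. -/

import Mathlib

open Filter

/-- Prefix complexity of `x` with respect to a prefix decompressor `D`. -/
noncomputable def Kc (D : List Bool →. List Bool) (x : List Bool) : ℕ∞ :=
  sInf {n : ℕ∞ | ∃ p : List Bool, x ∈ D p ∧ (p.length : ℕ∞) = n}

/-- `D` is a prefix function. -/
def PrefixFn (D : List Bool →. List Bool) : Prop :=
  ∀ p q : List Bool, p <+: q → p ≠ q → (D p).Dom → ¬(D q).Dom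

/-- `U` is an optimal prefix decompressor. -/
def OptimalPrefixDecompressor (U : List Bool →. List Bool) : Prop :=
  Partrec U ∧ PrefixFn U ∧
    ∀ D : List Bool →. List Bool, Partrec D → PrefixFn D →
      ∃ c : ℕ, ∀ x : List Bool, Kc U x ≤ Kc D x + (c : ℕ∞)

/-- `m` is a lower semicomputable semimeasure on binary strings. -/
def LscSemimeasure (m : List Bool → ℝ) : Prop :=
  (∀ x, 0 ≤ m x) ∧
  (∀ F : Finset (List Bool), ∑ x ∈ F, m x ≤ 1) ∧
  (∃ q : List Bool × ℕ → ℚ, Computable q ∧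
    (∀ x n, 0 ≤ q (x, n)) ∧
    (∀ x n, q (x, n) ≤ q (x, n + 1)) ∧
    (∀ x, Tendsto (fun n => (q (x, n) : ℝ)) atTop (nhds (m x))))

section Auxiliary

open Encodable Denumerable

/-- The code of a rational under the encoding through its numerator and denominator. -/
def Rat.pairCode (q : ℚ) : ℕ := Nat.pair (encode q.num) q.den

theorem Computable.of_consecutive {g : ℕ → ℕ} {p : ℕ → Bool} (hp : Computable p)
    (hlt : ∀ n, g n < g (n + 1)) (hg : ∀ n, p (g (n + 1)) = true)
    (hgap : ∀ n y, g n < y → y < g (n + 1) → p y = false) : Computable g := by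
  have hstep : Partrec₂ fun (_ : ℕ) (z : ℕ × ℕ) =>
      (Nat.rfind fun k => Part.some (p (z.2 + 1 + k))).map fun k => z.2 + 1 + k := by
    have hadd : Computable₂ fun (a : ℕ × (ℕ × ℕ)) (k : ℕ) => a.2.2 + 1 + k :=
      (Primrec.nat_add.comp (Primrec.succ.comp (Primrec.snd.comp (Primrec.snd.comp Primrec.fst)))
        Primrec.snd).to_comp
    have hpa : Computable₂ fun (a : ℕ × (ℕ × ℕ)) (k : ℕ) => p (a.2.2 + 1 + k) := hp.comp hadd
    exact (Partrec.rfind hpa.partrec₂).map hadd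
  refine Partrec.of_eq_tot (Partrec.nat_rec Computable.id (Computable.const (g 0)) hstep) ?_
  intro n
  induction n with
  | zero => exact Part.mem_some _
  | succ n ih =>
    refine Part.mem_bind ih ?_
    obtain ⟨k, hk⟩ := Nat.exists_eq_add_of_le (Nat.succ_le_of_lt (hlt n))
    rw [Part.mem_map_iff]
    refine ⟨k, ?_, hk.symm⟩
    refine Nat.mem_rfind.2 ⟨?_, fun {j} hj => ?_⟩
    · have := hg n
      rw [hk] at this
      simpa using this.symm
    · have := hgap n (g n + 1 + j) (by omega) (by omega)
      simpa using this.symm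

theorem Int.encode_natCast (n : ℕ) : encode (n : ℤ) = 2 * n := rfl

theorem Int.encode_negSucc (n : ℕ) : encode (Int.negSucc n) = 2 * n + 1 := rfl

theorem Int.natAbs_eq_encode (z : ℤ) : z.natAbs = (encode z + 1) / 2 := by
  cases z with
  | ofNat n =>
    rw [Int.ofNat_eq_natCast, Int.encode_natCast]; simp; omega
  | negSucc n => rw [Int.encode_negSucc]; simp; omega

theorem Int.encode_mod_two (z : ℤ) : encode z % 2 = 0 ↔ 0 ≤ z := by
  cases z with
  | ofNat n =>
    rw [Int.ofNat_eq_natCast, Int.encode_natCast]; simp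
  | negSucc n => rw [Int.encode_negSucc]; simp

theorem Rat.exists_pairCode_iff (n : ℕ) :
    (∃ q : ℚ, q.pairCode = n) ↔
      0 < n.unpair.2 ∧ ((n.unpair.1 + 1) / 2).Coprime n.unpair.2 := by
  constructor
  · rintro ⟨q, rfl⟩
    rw [Rat.pairCode, Nat.unpair_pair, ← Int.natAbs_eq_encode]
    exact ⟨q.den_pos, q.reduced⟩
  · rintro ⟨h0, h1⟩
    obtain ⟨z, hz⟩ : ∃ z : ℤ, encode z = n.unpair.1 := ⟨ofNat ℤ n.unpair.1, encode_ofNat _⟩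
    rw [← hz, ← Int.natAbs_eq_encode] at h1
    refine ⟨⟨z, n.unpair.2, h0.ne', h1⟩, ?_⟩
    rw [Rat.pairCode, hz, Nat.pair_unpair]

theorem PrimrecRel.nat_coprime : PrimrecRel Nat.Coprime := by
  have hdvd : PrimrecRel fun k n : ℕ => n % k = 0 :=
    Primrec.eq.comp (Primrec.nat_mod.comp Primrec.snd Primrec.fst) (Primrec.const 0)
  have h : PrimrecRel fun (k : ℕ) (y : ℕ × ℕ) =>
      ¬(y.1 % k = 0 ∧ y.2 % k = 0 ∧ 1 < k) :=
    .not (.and (hdvd.comp Primrec.fst (Primrec.fst.comp Primrec.snd))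
      (.and (hdvd.comp Primrec.fst (Primrec.snd.comp Primrec.snd))
        (Primrec.nat_lt.comp (Primrec.const 1) Primrec.fst)))
  have h2 : PrimrecPred fun y : ℕ × ℕ =>
      ∀ k < y.1 + y.2 + 1, ¬(y.1 % k = 0 ∧ y.2 % k = 0 ∧ 1 < k) :=
    (PrimrecRel.forall_mem_list h).comp (Primrec.list_range.comp <|
      Primrec.succ.comp (Primrec.nat_add.comp Primrec.fst Primrec.snd)) Primrec.id |>.of_eq
      fun y => by simp only [List.mem_range, id]
  have h3 : PrimrecPred fun y : ℕ × ℕ => 0 < y.1 + y.2 ∧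
      ∀ k < y.1 + y.2 + 1, ¬(y.1 % k = 0 ∧ y.2 % k = 0 ∧ 1 < k) :=
    .and (Primrec.nat_lt.comp (Primrec.const 0) (Primrec.nat_add.comp Primrec.fst Primrec.snd)) h2
  refine PrimrecPred.primrecRel (p := fun y : ℕ × ℕ => y.1.Coprime y.2) (h3.of_eq ?_)
  rintro ⟨a, b⟩
  dsimp only
  constructor
  · rintro ⟨hpos, hk⟩
    rw [Nat.Coprime]
    have h1 : a.gcd b ≠ 0 := by
      rw [Ne, Nat.gcd_eq_zero_iff]; omega
    have hle : a.gcd b ≤ a + b := by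
      rcases Nat.eq_zero_or_pos a with rfl | ha
      · simp
      · exact (Nat.gcd_le_left b ha).trans (by omega)
    by_contra hne
    exact hk (a.gcd b) (by omega) ⟨Nat.mod_eq_zero_of_dvd (Nat.gcd_dvd_left _ _),
      Nat.mod_eq_zero_of_dvd (Nat.gcd_dvd_right _ _), by omega⟩
  · intro hc
    refine ⟨?_, fun k _ ⟨h1, h2, h3⟩ => ?_⟩
    · by_contra hab
      obtain ⟨rfl, rfl⟩ : a = 0 ∧ b = 0 := by omega
      simp at hc
    · have := Nat.dvd_gcd (Nat.dvd_of_mod_eq_zero h1) (Nat.dvd_of_mod_eq_zero h2)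
      rw [hc, Nat.dvd_one] at this
      omega

theorem Rat.pairCode_ofNat_consecutive (n : ℕ) :
    (ofNat ℚ n).pairCode < (ofNat ℚ (n + 1)).pairCode ∧
      ∀ q : ℚ, (ofNat ℚ n).pairCode < q.pairCode →
        (ofNat ℚ (n + 1)).pairCode ≤ q.pairCode := by
  let := @decidableRangeEncode ℚ Rat.instEncodable
  let : Infinite (Set.range (@encode ℚ Rat.instEncodable)) :=
    Infinite.of_injective _ (Equiv.ofInjective _ (@encode_injective ℚ Rat.instEncodable)).injective
  have h (n) : (ofNat ℚ n).pairCode =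
      Nat.Subtype.ofNat (Set.range (@encode ℚ Rat.instEncodable)) n := by
    let := Nat.Subtype.denumerable (Set.range (@encode ℚ Rat.instEncodable))
    have e : ofNat ℚ n = (@equivRangeEncode ℚ Rat.instEncodable).symm
        (Nat.Subtype.ofNat (Set.range (@encode ℚ Rat.instEncodable)) n) :=
      (Denumerable.ofEquiv_ofNat (Set.range (@encode ℚ Rat.instEncodable))
        (@equivRangeEncode ℚ Rat.instEncodable) n)
    rw [e]
    exact congrArg Subtype.val
      ((@equivRangeEncode ℚ Rat.instEncodable).apply_symm_apply _)
  rw [h, h]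
  refine ⟨Nat.Subtype.lt_succ_self _, fun q hq => ?_⟩
  have hmem : q.pairCode ∈ Set.range (@encode ℚ Rat.instEncodable) := ⟨q, rfl⟩
  exact Nat.Subtype.succ_le_of_lt (x := ⟨q.pairCode, hmem⟩) hq

theorem Rat.computable_pairCode : Computable Rat.pairCode := by
  have hp : PrimrecPred fun n : ℕ =>
      0 < n.unpair.2 ∧ ((n.unpair.1 + 1) / 2).Coprime n.unpair.2 :=
    .and (Primrec.nat_lt.comp (Primrec.const 0) (Primrec.snd.comp Primrec.unpair))
      (PrimrecRel.nat_coprime.comp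
        (Primrec.nat_div.comp (Primrec.succ.comp (Primrec.fst.comp Primrec.unpair))
          (Primrec.const 2))
        (Primrec.snd.comp Primrec.unpair))
  have hg : Computable fun n => (ofNat ℚ n).pairCode := by
    refine Computable.of_consecutive hp.decide.to_comp
      (fun n => (Rat.pairCode_ofNat_consecutive n).1)
      (fun n => decide_eq_true ((Rat.exists_pairCode_iff _).1 ⟨_, rfl⟩))
      (fun n y hy hlt => decide_eq_false fun h => ?_)
    obtain ⟨q, rfl⟩ := (Rat.exists_pairCode_iff _).2 h
    exact absurd ((Rat.pairCode_ofNat_consecutive n).2 q hy) (not_le.2 hlt)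
  exact (hg.comp Computable.encode).of_eq fun q => by rw [ofNat_encode]

theorem Rat.computable_den : Computable Rat.den :=
  (Computable.snd.comp (Computable.unpair.comp Rat.computable_pairCode)).of_eq fun q => by
    rw [Rat.pairCode, Nat.unpair_pair]

theorem Rat.computable_encode_num : Computable fun q : ℚ => encode q.num :=
  (Computable.fst.comp (Computable.unpair.comp Rat.computable_pairCode)).of_eq fun q => by
    rw [Rat.pairCode, Nat.unpair_pair]

theorem Rat.computable_natAbs_num : Computable fun q : ℚ => q.num.natAbs :=
  ((Primrec.nat_div.comp Primrec.succ (Primrec.const 2)).to_comp.comp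
    Rat.computable_encode_num).of_eq fun _ => (Int.natAbs_eq_encode _).symm

/-- A function into a denumerable type with computable graph is computable. -/
theorem Computable.of_graph {α σ : Type*} [Primcodable α] [Denumerable σ] {f : α → σ}
    {p : α → σ → Bool} (hp : Computable₂ p) (h : ∀ x y, p x y = true ↔ y = f x) :
    Computable f := by
  have hp' : Computable₂ fun (x : α) (n : ℕ) => p x (ofNat σ n) :=
    hp.comp .fst ((Computable.ofNat σ).comp .snd)
  have ho : Computable₂ fun (_ : α) (n : ℕ) => ofNat σ n := (Computable.ofNat σ).comp .snd
  have hr := (Partrec.rfind hp'.partrec₂).map ho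
  refine Partrec.of_eq_tot hr fun x => ?_
  obtain ⟨n, hn, -⟩ := Nat.rfind_min' (p := fun n => p x (ofNat σ n)) (m := encode (f x))
    (by simp [h])
  refine (Part.mem_map_iff _).2 ⟨n, hn, (h _ _).1 ?_⟩
  exact (Part.mem_some_iff.1 (Nat.rfind_spec hn)).symm

theorem Computable.rat_natCast_div {α : Type*} [Primcodable α] {a b : α → ℕ} (ha : Computable a)
    (hb : Computable b) (hpos : ∀ x, 0 < b x) : Computable fun x => (a x / b x : ℚ) := by
  have hdec (e n d : α × ℚ → ℕ) (he : Computable e) (hn : Computable n) (hd : Computable d) :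
      Computable fun v => decide (e v % 2 = 0 ∧ n v * b v.1 = a v.1 * d v) := by
    have h : Primrec fun v : (ℕ × ℕ) × (ℕ × ℕ × ℕ) =>
        decide (v.1.1 % 2 = 0 ∧ v.1.2 * v.2.1 = v.2.2.1 * v.2.2.2) :=
      PrimrecPred.decide (.and (Primrec.eq.comp (Primrec.nat_mod.comp
        (Primrec.fst.comp Primrec.fst) (Primrec.const 2)) (Primrec.const 0))
        (Primrec.eq.comp (Primrec.nat_mul.comp (Primrec.snd.comp Primrec.fst)
          (Primrec.fst.comp Primrec.snd))
          (Primrec.nat_mul.comp (Primrec.fst.comp (Primrec.snd.comp Primrec.snd))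
            (Primrec.snd.comp (Primrec.snd.comp Primrec.snd)))))
    exact h.to_comp.comp ((he.pair hn).pair
      ((hb.comp .fst).pair ((ha.comp .fst).pair hd)))
  have hiff (x : α) (q : ℚ) : (encode q.num % 2 = 0 ∧ q.num.natAbs * b x = a x * q.den) ↔
      q = a x / b x := by
    have hb' : (b x : ℚ) ≠ 0 := Nat.cast_ne_zero.2 (hpos x).ne'
    have hd : (q.den : ℚ) ≠ 0 := Nat.cast_ne_zero.2 q.den_nz
    rw [Int.encode_mod_two]
    have key : 0 ≤ q.num → (q.num.natAbs * b x = a x * q.den ↔ q = a x / b x) := by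
      intro h
      rw [eq_div_iff hb']
      conv_rhs => rw [← Rat.num_div_den q, div_mul_eq_mul_div, div_eq_iff hd]
      rw [← Int.natCast_inj]
      push_cast
      rw [abs_of_nonneg h]
      exact_mod_cast Iff.rfl
    constructor
    · exact fun h => (key h.1).1 h.2
    · intro h
      have h0 : 0 ≤ q.num := Rat.num_nonneg.2 (by rw [h]; positivity)
      exact ⟨h0, (key h0).2 h⟩
  have hq : Computable fun v : α × ℚ => v.2 := .snd
  refine Computable.of_graph (hdec _ _ _ (Rat.computable_encode_num.comp hq)
    (Rat.computable_natAbs_num.comp hq) (Rat.computable_den.comp hq)).to₂ fun x y => ?_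
  rw [decide_eq_true_iff]
  exact hiff x y

/-- The natural number with binary expansion `p`, most significant bit first. -/
def bitsVal (p : List Bool) : ℕ := p.foldl (fun a b => 2 * a + b.toNat) 0

theorem bitsVal_concat (p : List Bool) (b : Bool) :
    bitsVal (p ++ [b]) = 2 * bitsVal p + b.toNat := by
  simp [bitsVal]

theorem bitsVal_append (p r : List Bool) :
    bitsVal (p ++ r) = bitsVal p * 2 ^ r.length + bitsVal r := by
  induction r using List.reverseRecOn with
  | nil => simp [bitsVal]
  | append_singleton r b ih =>
    rw [← List.append_assoc, bitsVal_concat, ih, bitsVal_concat, List.length_append,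
      List.length_singleton, pow_succ]
    ring

theorem bitsVal_lt (p : List Bool) : bitsVal p < 2 ^ p.length := by
  induction p using List.reverseRecOn with
  | nil => simp [bitsVal]
  | append_singleton p b ih =>
    rw [bitsVal_concat, List.length_append, List.length_singleton, pow_succ]
    have := b.toNat_lt
    omega

theorem exists_bitsVal_eq {L v : ℕ} (h : v < 2 ^ L) :
    ∃ p : List Bool, p.length = L ∧ bitsVal p = v := by
  induction L generalizing v with
  | zero => exact ⟨[], rfl, by simp at h; simp [bitsVal, h]⟩
  | succ L ih =>
    obtain ⟨p, hp, hv⟩ := ih (v := v / 2) (by rw [pow_succ] at h; omega)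
    refine ⟨p ++ [decide (v % 2 = 1)], by simp [hp], ?_⟩
    rw [bitsVal_concat, hv]
    rcases Nat.mod_two_eq_zero_or_one v with h | h <;> simp [h] <;> omega

theorem Primrec.bitsVal : Primrec bitsVal :=
  have h : Primrec₂ fun (_ : List Bool) (z : ℕ × Bool) => 2 * z.1 + z.2.toNat :=
    Primrec.nat_add.comp
      (Primrec.nat_mul.comp (Primrec.const 2) (Primrec.fst.comp Primrec.snd))
      ((Primrec.dom_bool Bool.toNat).comp (Primrec.snd.comp Primrec.snd))
  Primrec.list_foldl Primrec.id (Primrec.const 0) h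

theorem Primrec.two_pow : Primrec fun n : ℕ => 2 ^ n :=
  (Primrec₂.unpaired'.1 Nat.Primrec.pow).comp (Primrec.const 2) Primrec.id

/-- Left endpoint of the dyadic interval of the reals whose expansion starts with `p`. -/
noncomputable def dyadicLo (p : List Bool) : ℝ := bitsVal p / 2 ^ p.length

/-- Right endpoint of the dyadic interval of the reals whose expansion starts with `p`. -/
noncomputable def dyadicHi (p : List Bool) : ℝ := (bitsVal p + 1) / 2 ^ p.length

theorem dyadicLo_lt_dyadicHi (p : List Bool) : dyadicLo p < dyadicHi p := by
  unfold dyadicLo dyadicHi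
  gcongr
  linarith

theorem List.IsPrefix.dyadicLo_le {p q : List Bool} (h : p <+: q) : dyadicLo p ≤ dyadicLo q := by
  obtain ⟨r, rfl⟩ := h
  rw [dyadicLo, dyadicLo, bitsVal_append, List.length_append, div_le_div_iff₀ (by positivity)
    (by positivity), pow_add]
  push_cast
  have : (0 : ℝ) ≤ bitsVal r * 2 ^ p.length := by positivity
  linarith

theorem List.IsPrefix.dyadicHi_le {p q : List Bool} (h : p <+: q) : dyadicHi q ≤ dyadicHi p := by
  obtain ⟨r, rfl⟩ := h
  rw [dyadicHi, dyadicHi, bitsVal_append, List.length_append, div_le_div_iff₀ (by positivity)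
    (by positivity), pow_add]
  have h1 : (bitsVal r : ℝ) + 1 ≤ 2 ^ r.length := by exact_mod_cast bitsVal_lt r
  have h2 := mul_le_mul_of_nonneg_right h1 (by positivity : (0 : ℝ) ≤ 2 ^ p.length)
  push_cast
  linarith

theorem exists_dyadic_between {a b : ℝ} {k : ℕ} (ha : 0 ≤ a) (hb : b ≤ 1)
    (hab : a + (1 / 2) ^ k ≤ b) :
    ∃ p : List Bool, p.length = k + 1 ∧ a ≤ dyadicLo p ∧ dyadicHi p ≤ b := by
  have hpow : (0 : ℝ) < 2 ^ (k + 1) := by positivity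
  have hk : ((1 : ℝ) / 2) ^ k = 2 / 2 ^ (k + 1) := by
    rw [one_div, inv_pow, pow_succ]; field_simp
  have hlt : (⌈a * 2 ^ (k + 1)⌉₊ : ℝ) < a * 2 ^ (k + 1) + 1 := Nat.ceil_lt_add_one (by positivity)
  have hle : (⌈a * 2 ^ (k + 1)⌉₊ : ℝ) + 1 ≤ b * 2 ^ (k + 1) := by
    have := mul_le_mul_of_nonneg_right hab hpow.le
    rw [hk, add_mul, div_mul_cancel₀ _ hpow.ne'] at this
    linarith
  have hv : ⌈a * 2 ^ (k + 1)⌉₊ < 2 ^ (k + 1) := by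
    have : (⌈a * 2 ^ (k + 1)⌉₊ : ℝ) < 2 ^ (k + 1) := by nlinarith
    exact_mod_cast this
  obtain ⟨p, hp, hpv⟩ := exists_bitsVal_eq hv
  refine ⟨p, hp, ?_, ?_⟩
  · rw [dyadicLo, hp, hpv, le_div_iff₀ hpow]
    exact Nat.le_ceil _
  · rw [dyadicHi, hp, hpv, div_le_iff₀ hpow]
    exact hle

/-- The integer form of the inclusion of a dyadic interval in the segment of a request. -/
def fitsSegment (v : (ℕ × ℕ) × (ℕ × ℕ) × (ℕ × ℕ)) : Bool :=
  decide (v.1.1 + 2 = v.1.2 ∧ v.2.1.1 * 2 ^ v.1.2 ≤ v.2.2.1 * 2 ^ v.2.2.2 ∧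
    (v.2.2.1 + 1) * 2 ^ (v.2.2.2 + 1) ≤ v.2.1.2 * 2 ^ v.1.2)

theorem Primrec.fitsSegment : Primrec fitsSegment := by
  have h11 : Primrec fun v : (ℕ × ℕ) × (ℕ × ℕ) × (ℕ × ℕ) => v.1.1 := Primrec.fst.comp Primrec.fst
  have h12 : Primrec fun v : (ℕ × ℕ) × (ℕ × ℕ) × (ℕ × ℕ) => v.1.2 := Primrec.snd.comp Primrec.fst
  have h21 : Primrec fun v : (ℕ × ℕ) × (ℕ × ℕ) × (ℕ × ℕ) => v.2.1.1 :=
    Primrec.fst.comp (Primrec.fst.comp Primrec.snd)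
  have h22 : Primrec fun v : (ℕ × ℕ) × (ℕ × ℕ) × (ℕ × ℕ) => v.2.1.2 :=
    Primrec.snd.comp (Primrec.fst.comp Primrec.snd)
  have h31 : Primrec fun v : (ℕ × ℕ) × (ℕ × ℕ) × (ℕ × ℕ) => v.2.2.1 :=
    Primrec.fst.comp (Primrec.snd.comp Primrec.snd)
  have h32 : Primrec fun v : (ℕ × ℕ) × (ℕ × ℕ) × (ℕ × ℕ) => v.2.2.2 :=
    Primrec.snd.comp (Primrec.snd.comp Primrec.snd)
  exact PrimrecPred.decide (.and
    (Primrec.eq.comp (Primrec.nat_add.comp h11 (Primrec.const 2)) h12) (.and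
    (Primrec.nat_le.comp (Primrec.nat_mul.comp h21 (Primrec.two_pow.comp h12))
      (Primrec.nat_mul.comp h31 (Primrec.two_pow.comp h32)))
    (Primrec.nat_le.comp
      (Primrec.nat_mul.comp (Primrec.succ.comp h31) (Primrec.two_pow.comp (Primrec.succ.comp h32)))
      (Primrec.nat_mul.comp h22 (Primrec.two_pow.comp h12)))))

section Requests

variable (r : ℕ → Option (List Bool × ℕ))

/-- The weight of a request for a codeword. -/
noncomputable def requestWeight (o : Option (List Bool × ℕ)) : ℝ :=
  o.elim 0 fun a => (1 / 2) ^ (a.2 + 1)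

theorem requestWeight_nonneg (o : Option (List Bool × ℕ)) : 0 ≤ requestWeight o := by
  cases o <;> simp [requestWeight]

/-- The total weight of the first `t` requests, scaled by `2 ^ t`. -/
def allocated (t : ℕ) : ℕ :=
  Nat.rec 0 (fun s y => 2 * y + (r s).elim 0 fun a => 2 ^ (s - a.2)) t

/-- `p` may serve request `t` if its dyadic interval lies in the segment allotted to `t`. -/
def serves (p : List Bool) (t : ℕ) : Option (List Bool) :=
  (r t).bind fun a =>
    bif fitsSegment ((a.2, p.length), (allocated r t, allocated r (t + 1)), bitsVal p, t)
    then some a.1 else none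

variable {r}

theorem Computable.allocated (hr : Computable r) : Computable (allocated r) := by
  have hstep : Primrec₂ fun (o : Option (List Bool × ℕ)) (z : ℕ × ℕ) =>
      2 * z.2 + o.elim 0 fun a => 2 ^ (z.1 - a.2) := by
    refine Primrec.nat_add.comp (Primrec.nat_mul.comp (Primrec.const 2)
      (Primrec.snd.comp Primrec.snd)) ?_
    have h : Primrec₂ fun (v : Option (List Bool × ℕ) × (ℕ × ℕ)) (a : List Bool × ℕ) =>
        2 ^ (v.2.1 - a.2) :=
      Primrec.two_pow.comp (Primrec.nat_sub.comp
        (Primrec.fst.comp (Primrec.snd.comp Primrec.fst)) (Primrec.snd.comp Primrec.snd))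
    exact (Primrec.option_casesOn Primrec.fst (Primrec.const 0) h).of_eq fun v => by
      cases v.1 <;> rfl
  have hstep' : Computable₂ fun (_ : ℕ) (z : ℕ × ℕ) =>
      2 * z.2 + (r z.1).elim 0 fun a => 2 ^ (z.1 - a.2) :=
    hstep.to_comp.comp (hr.comp (Computable.fst.comp .snd)) .snd
  exact Computable.nat_rec Computable.id (Computable.const 0) hstep'

theorem Computable.serves (hr : Computable r) : Computable₂ (serves r) := by
  have hal := Computable.allocated hr
  have ht : Computable fun v : (List Bool × ℕ) × (List Bool × ℕ) => v.1.2 :=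
    Computable.snd.comp .fst
  have hp : Computable fun v : (List Bool × ℕ) × (List Bool × ℕ) => v.1.1 :=
    Computable.fst.comp .fst
  have hc : Computable fun v : (List Bool × ℕ) × (List Bool × ℕ) =>
      fitsSegment ((v.2.2, v.1.1.length), (_root_.allocated r v.1.2,
        _root_.allocated r (v.1.2 + 1)), _root_.bitsVal v.1.1, v.1.2) :=
    Primrec.fitsSegment.to_comp.comp
      (((Computable.snd.comp .snd).pair (Computable.list_length.comp hp)).pair
      (((hal.comp ht).pair (hal.comp (Computable.succ.comp ht))).pair
        ((Primrec.bitsVal.to_comp.comp hp).pair ht)))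
  have hx : Computable fun v : (List Bool × ℕ) × (List Bool × ℕ) => some v.2.1 :=
    Computable.option_some.comp (Computable.fst.comp .snd)
  have hrt : Computable fun v : List Bool × ℕ => r v.2 := hr.comp .snd
  exact Computable.option_bind hrt (Computable.cond hc hx (Computable.const none)).to₂

variable (hk : ∀ t a, r t = some a → a.2 ≤ t)
include hk

theorem allocated_div_two_pow (t : ℕ) :
    (allocated r t : ℝ) / 2 ^ t = ∑ s ∈ Finset.range t, requestWeight (r s) := by
  induction t with
  | zero => simp [allocated]
  | succ t ih =>
    have hs : allocated r (t + 1) =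
        2 * allocated r t + (r t).elim 0 fun a => 2 ^ (t - a.2) := rfl
    rw [Finset.sum_range_succ, ← ih, hs]
    rcases h : r t with _ | a
    · simp [requestWeight, pow_succ]; field_simp
    · obtain ⟨d, rfl⟩ := Nat.exists_eq_add_of_le (hk t a h)
      simp [requestWeight, pow_succ, pow_add]; field_simp

theorem mem_serves_iff {p x : List Bool} {t : ℕ} : x ∈ serves r p t ↔
    ∃ k, r t = some (x, k) ∧ p.length = k + 2 ∧
      ∑ s ∈ Finset.range t, requestWeight (r s) ≤ dyadicLo p ∧
      dyadicHi p ≤ ∑ s ∈ Finset.range (t + 1), requestWeight (r s) := by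
  rw [← allocated_div_two_pow hk, ← allocated_div_two_pow hk, dyadicLo, dyadicHi,
    div_le_div_iff₀ (by positivity) (by positivity),
    div_le_div_iff₀ (by positivity) (by positivity), serves, Option.mem_def,
    Option.bind_eq_some_iff]
  norm_cast
  constructor
  · rintro ⟨⟨y, k⟩, hy, h⟩
    rcases hc : fitsSegment
      ((k, p.length), (allocated r t, allocated r (t + 1)), bitsVal p, t) with _ | _
    · simp [hc] at h
    · rw [hc, cond_true, Option.some.injEq] at h
      rw [fitsSegment, decide_eq_true_iff] at hc
      exact ⟨k, h ▸ hy, hc.1.symm, hc.2⟩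
  · rintro ⟨k, hy, h1, h2⟩
    refine ⟨(x, k), hy, ?_⟩
    rw [fitsSegment, decide_eq_true (by exact ⟨h1.symm, h2⟩), cond_true]

theorem eq_of_mem_serves {p q x y : List Bool} {s t : ℕ} (hpq : p <+: q)
    (hp : x ∈ serves r p t) (hq : y ∈ serves r q s) : t = s := by
  rw [mem_serves_iff hk] at hp hq
  obtain ⟨_, -, -, hp1, hp2⟩ := hp
  obtain ⟨_, -, -, hq1, hq2⟩ := hq
  have hmono : Monotone fun t => ∑ s ∈ Finset.range t, requestWeight (r s) :=
    monotone_nat_of_le_succ fun t => by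
      simp only [Finset.sum_range_succ]
      linarith [requestWeight_nonneg (r t)]
  have h1 := hpq.dyadicLo_le
  have h2 := hpq.dyadicHi_le
  have h3 := dyadicLo_lt_dyadicHi q
  rcases lt_trichotomy t s with h | h | h
  · have := hmono (Nat.succ_le_of_lt h)
    simp only [Nat.succ_eq_add_one] at this
    linarith
  · exact h
  · have := hmono (Nat.succ_le_of_lt h)
    simp only [Nat.succ_eq_add_one] at this
    linarith

/-- Kraft–Chaitin: a computable stream of requests of total weight at most `1` is served
by a prefix decompressor. -/
theorem exists_prefixFn_of_requests (hr : Computable r)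
    (hsum : ∀ t, ∑ s ∈ Finset.range t, requestWeight (r s) ≤ 1) :
    ∃ D : List Bool →. List Bool, Partrec D ∧ PrefixFn D ∧
      ∀ t x k, r t = some (x, k) → ∃ p : List Bool, x ∈ D p ∧ p.length = k + 2 := by
  refine ⟨fun p => Nat.rfindOpt (serves r p), Partrec.rfindOpt (Computable.serves hr), ?_, ?_⟩
  · intro p q hpq hne hp hq
    obtain ⟨t, x, hx⟩ := Nat.rfindOpt_dom.1 hp
    obtain ⟨s, y, hy⟩ := Nat.rfindOpt_dom.1 hq
    obtain rfl := eq_of_mem_serves hk hpq hx hy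
    obtain ⟨k, h1, h2, -⟩ := (mem_serves_iff hk).1 hx
    obtain ⟨j, h3, h4, -⟩ := (mem_serves_iff hk).1 hy
    rw [h1, Option.some.injEq, Prod.mk.injEq] at h3
    exact hne (hpq.eq_of_length (by rw [h2, h4, h3.2]))
  · intro t x k ht
    obtain ⟨p, hp, hlo, hhi⟩ := exists_dyadic_between
      (a := ∑ s ∈ Finset.range t, requestWeight (r s)) (k := k + 1)
      (Finset.sum_nonneg fun s _ => requestWeight_nonneg (r s)) (hsum (t + 1))
      (by rw [Finset.sum_range_succ, ht]; rfl)
    have hx : x ∈ serves r p t := (mem_serves_iff hk).2 ⟨k, ht, hp, hlo, hhi⟩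
    refine ⟨p, ?_, hp⟩
    obtain ⟨y, hy⟩ := Part.dom_iff_mem.1 (Nat.rfindOpt_dom.2 ⟨t, x, hx⟩)
    obtain ⟨s, hs⟩ := Nat.rfindOpt_spec hy
    obtain rfl := eq_of_mem_serves hk (List.prefix_refl p) hx hs
    rwa [Option.mem_unique hx hs]

end Requests

theorem sum_half_pow_le {y : ℝ} (hy : 0 ≤ y) (K : ℕ) :
    ∑ k ∈ Finset.range K, (if (1 / 2 : ℝ) ^ k < y then (1 / 2 : ℝ) ^ (k + 1) else 0) ≤ y := by
  induction K generalizing y with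
  | zero => simpa
  | succ K ih =>
    rcases lt_or_ge 1 y with h | h
    · have hgeom (N : ℕ) : ∑ k ∈ Finset.range N, (1 / 2 : ℝ) ^ (k + 1) = 1 - (1 / 2) ^ N := by
        induction N with
        | zero => simp
        | succ N ih => rw [Finset.sum_range_succ, ih]; ring
      calc _ ≤ ∑ k ∈ Finset.range (K + 1), (1 / 2 : ℝ) ^ (k + 1) := by
            refine Finset.sum_le_sum fun k _ => ?_
            split_ifs
            · exact le_rfl
            · positivity
        _ ≤ y := by
            rw [hgeom]
            have : (0 : ℝ) ≤ (1 / 2) ^ (K + 1) := by positivity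
            linarith
    · rw [Finset.sum_range_succ', pow_zero, if_neg h.not_gt, add_zero]
      have h2 := ih (y := 2 * y) (by linarith)
      refine le_trans (le_of_eq ?_) (by linarith [h2] :
        1 / 2 * (∑ k ∈ Finset.range K,
          if (1 / 2 : ℝ) ^ k < 2 * y then (1 / 2 : ℝ) ^ (k + 1) else 0) ≤ y)
      rw [Finset.mul_sum]
      refine Finset.sum_congr rfl fun k _ => ?_
      have : (1 / 2 : ℝ) ^ (k + 1) < y ↔ (1 / 2 : ℝ) ^ k < 2 * y := by
        rw [pow_succ]; constructor <;> intro h <;> linarith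
      simp only [this, mul_ite, mul_zero]
      congr 1
      ring

section Upper

/-- Whether the `n`-th approximation at `x` exceeds `2 ^ (-k)`, where `v = (x, k, n)`. -/
def exceeds (q : List Bool × ℕ → ℚ) (v : List Bool × ℕ × ℕ) : Bool :=
  decide ((q (v.1, v.2.2)).den < (q (v.1, v.2.2)).num.natAbs * 2 ^ v.2.1)

/-- Whether `n` is the first index at which the approximation at `x` exceeds `2 ^ (-k)`. -/
def firstExceeds (q : List Bool × ℕ → ℚ) (v : List Bool × ℕ × ℕ) : Bool :=
  exceeds q v && (decide (v.2.2 = 0) || !exceeds q (v.1, v.2.1, v.2.2 - 1))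

/-- The request stream asking for a codeword of `x` whenever an approximation first exceeds
a power of two. -/
def thresholdRequest (q : List Bool × ℕ → ℚ) (t : ℕ) : Option (List Bool × ℕ) :=
  (decode (α := List Bool × ℕ × ℕ) t).bind fun v =>
    bif firstExceeds q v && decide (encode v = t) then some (v.1, v.2.1) else none

variable {q : List Bool × ℕ → ℚ}

theorem Computable.exceeds (hq : Computable q) : Computable (exceeds q) := by
  have hlt : Primrec fun v : (ℕ × ℕ) × ℕ => decide (v.1.1 < v.1.2 * 2 ^ v.2) :=
    PrimrecPred.decide (Primrec.nat_lt.comp (Primrec.fst.comp Primrec.fst)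
      (Primrec.nat_mul.comp (Primrec.snd.comp Primrec.fst) (Primrec.two_pow.comp Primrec.snd)))
  have hqv : Computable fun v : List Bool × ℕ × ℕ => q (v.1, v.2.2) :=
    hq.comp (Computable.fst.pair (Computable.snd.comp .snd))
  have hk : Computable fun v : List Bool × ℕ × ℕ => v.2.1 := Computable.fst.comp .snd
  exact hlt.to_comp.comp
    (((Rat.computable_den.comp hqv).pair (Rat.computable_natAbs_num.comp hqv)).pair hk)

theorem Computable.firstExceeds (hq : Computable q) : Computable (firstExceeds q) := by
  have hx : Computable fun v : List Bool × ℕ × ℕ => v.1 := Computable.fst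
  have hk : Computable fun v : List Bool × ℕ × ℕ => v.2.1 := Computable.fst.comp .snd
  have hn : Computable fun v : List Bool × ℕ × ℕ => v.2.2 := Computable.snd.comp .snd
  have hz : Computable fun v : List Bool × ℕ × ℕ => decide (v.2.2 = 0) :=
    (PrimrecPred.decide (Primrec.eq.comp (Primrec.snd.comp Primrec.snd)
      (Primrec.const 0))).to_comp
  have he := Computable.exceeds hq
  have hp : Computable fun v : List Bool × ℕ × ℕ => _root_.exceeds q (v.1, v.2.1, v.2.2 - 1) :=
    he.comp (hx.pair (hk.pair (Computable.pred.comp hn)))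
  exact Primrec.and.to_comp.comp he
    (Primrec.or.to_comp.comp hz (Primrec.not.to_comp.comp hp))

theorem Computable.thresholdRequest (hq : Computable q) : Computable (thresholdRequest q) := by
  have hf : Computable fun w : ℕ × (List Bool × ℕ × ℕ) => _root_.firstExceeds q w.2 :=
    (Computable.firstExceeds hq).comp .snd
  have he : Computable fun w : ℕ × (List Bool × ℕ × ℕ) => decide (encode w.2 = w.1) :=
    (PrimrecPred.decide (Primrec.eq.comp (Primrec.encode.comp Primrec.snd) Primrec.fst)).to_comp
  have hc : Computable fun w : ℕ × (List Bool × ℕ × ℕ) =>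
      _root_.firstExceeds q w.2 && decide (encode w.2 = w.1) := Primrec.and.to_comp.comp hf he
  have hs : Computable fun w : ℕ × (List Bool × ℕ × ℕ) => some (w.2.1, w.2.2.1) :=
    Computable.option_some.comp ((Computable.fst.comp .snd).pair
      (Computable.fst.comp (Computable.snd.comp .snd)))
  exact Computable.option_bind Computable.decode (Computable.cond hc hs (Computable.const none)).to₂

theorem thresholdRequest_eq_some_iff {t : ℕ} {x : List Bool} {k : ℕ} :
    thresholdRequest q t = some (x, k) ↔
      ∃ n, encode (x, k, n) = t ∧ firstExceeds q (x, k, n) = true := by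
  rw [thresholdRequest, Option.bind_eq_some_iff]
  constructor
  · rintro ⟨⟨y, j, n⟩, -, h⟩
    rcases hc : firstExceeds q (y, j, n) && decide (encode (y, j, n) = t) with _ | _
    · rw [hc] at h; simp at h
    · rw [hc, cond_true, Option.some.injEq, Prod.mk.injEq] at h
      obtain ⟨rfl, rfl⟩ := h
      rw [Bool.and_eq_true, decide_eq_true_iff] at hc
      exact ⟨n, hc.2, hc.1⟩
  · rintro ⟨n, rfl, h⟩
    exact ⟨(x, k, n), encodek _, by simp [h]⟩

theorem snd_le_of_thresholdRequest (t : ℕ) (a : List Bool × ℕ)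
    (h : thresholdRequest q t = some a) : a.2 ≤ t := by
  obtain ⟨n, rfl, -⟩ := thresholdRequest_eq_some_iff.1 h
  exact (Nat.left_le_pair a.2 n).trans (Nat.right_le_pair (encode a.1) _)

theorem le_of_tendsto_approx {m : List Bool → ℝ} (h1 : ∀ x n, q (x, n) ≤ q (x, n + 1))
    (hlim : ∀ x, Tendsto (fun n => (q (x, n) : ℝ)) atTop (nhds (m x)))
    (x : List Bool) (n : ℕ) : (q (x, n) : ℝ) ≤ m x := by
  have hm : Monotone fun n => (q (x, n) : ℝ) :=
    monotone_nat_of_le_succ fun n => by exact_mod_cast h1 x n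
  exact hm.ge_of_tendsto (hlim x) n

variable (h0 : ∀ x n, 0 ≤ q (x, n))
include h0

theorem exceeds_iff {x : List Bool} {k n : ℕ} :
    exceeds q (x, k, n) = true ↔ (1 / 2 : ℝ) ^ k < q (x, n) := by
  have hq : (q (x, n) : ℝ) = ((q (x, n)).num.natAbs : ℝ) / (q (x, n)).den := by
    have hn : ((q (x, n)).num.natAbs : ℤ) = (q (x, n)).num :=
      Int.natAbs_of_nonneg (Rat.num_nonneg.2 (h0 x n))
    rw [Rat.cast_def, ← hn]
    simp
  have hd : (0 : ℝ) < (q (x, n)).den := by exact_mod_cast (q (x, n)).den_pos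
  rw [exceeds, decide_eq_true_iff, hq, one_div, inv_pow, lt_div_iff₀ hd,
    inv_mul_lt_iff₀ (by positivity), mul_comm ((2 : ℝ) ^ k)]
  norm_cast

theorem exists_firstExceeds {x : List Bool} {k n : ℕ} (h : (1 / 2 : ℝ) ^ k < q (x, n)) :
    ∃ i, firstExceeds q (x, k, i) = true := by
  classical
  have hex : ∃ i, exceeds q (x, k, i) = true := ⟨n, (exceeds_iff h0).2 h⟩
  refine ⟨Nat.find hex, ?_⟩
  rw [firstExceeds, Bool.and_eq_true, Bool.or_eq_true, decide_eq_true_iff]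
  refine ⟨Nat.find_spec hex, ?_⟩
  by_cases hz : Nat.find hex = 0
  · exact .inl hz
  · right
    rw [Bool.not_eq_true', ← Bool.not_eq_true]
    exact Nat.find_min hex (by simp only; omega)

variable (h1 : ∀ x n, q (x, n) ≤ q (x, n + 1))
include h1

theorem eq_of_firstExceeds {x : List Bool} {k i j : ℕ} (hi : firstExceeds q (x, k, i) = true)
    (hj : firstExceeds q (x, k, j) = true) : i = j := by
  have hm : Monotone fun n => (q (x, n) : ℝ) :=
    monotone_nat_of_le_succ fun n => by exact_mod_cast h1 x n
  have key {i j : ℕ} (hi : firstExceeds q (x, k, i) = true)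
      (hj : firstExceeds q (x, k, j) = true) : i ≤ j := by
    by_contra! hlt
    rw [firstExceeds, Bool.and_eq_true, Bool.or_eq_true, decide_eq_true_iff] at hi hj
    rcases hi.2 with h | h
    · simp only at h; omega
    · rw [Bool.not_eq_true', ← Bool.not_eq_true, exceeds_iff h0] at h
      exact h (((exceeds_iff h0).1 hj.1).trans_le (hm (Nat.le_sub_one_of_lt hlt)))
  exact le_antisymm (key hi hj) (key hj hi)

variable {m : List Bool → ℝ} (hlim : ∀ x, Tendsto (fun n => (q (x, n) : ℝ)) atTop (nhds (m x)))
  (hsum : ∀ F : Finset (List Bool), ∑ x ∈ F, m x ≤ 1)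
include hlim hsum

theorem sum_thresholdRequest_le (T : ℕ) :
    ∑ t ∈ Finset.range T, requestWeight (thresholdRequest q t) ≤ 1 := by
  classical
  set A := (Finset.range T).filter fun t => (thresholdRequest q t).isSome = true with hA
  obtain ⟨g, hAg⟩ : ∃ g : ℕ → List Bool × ℕ, ∀ t ∈ A, thresholdRequest q t = some (g t) := by
    refine ⟨fun t => (thresholdRequest q t).getD ([], 0), fun t ht => ?_⟩
    obtain ⟨a, ha⟩ := Option.isSome_iff_exists.1 (Finset.mem_filter.1 ht).2
    simp [ha]
  have hinj : Set.InjOn g A := by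
    intro s hs t ht hst
    obtain ⟨i, hi, hi'⟩ := thresholdRequest_eq_some_iff.1 (hAg s hs)
    obtain ⟨j, hj, hj'⟩ := thresholdRequest_eq_some_iff.1 (hAg t ht)
    rw [← hst] at hj hj'
    rw [← hi, ← hj, eq_of_firstExceeds h0 h1 hi' hj']
  set w : List Bool × ℕ → ℝ := fun z =>
    if (1 / 2 : ℝ) ^ z.2 < m z.1 then (1 / 2 : ℝ) ^ (z.2 + 1) else 0 with hw
  have hw0 (z) : 0 ≤ w z := by simp only [hw]; split_ifs <;> positivity
  have hm0 (x) : 0 ≤ m x :=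
    le_trans (by exact_mod_cast h0 x 0) (le_of_tendsto_approx h1 hlim x 0)
  set F := A.image fun t => (g t).1 with hF
  calc ∑ t ∈ Finset.range T, requestWeight (thresholdRequest q t)
      = ∑ t ∈ A, requestWeight (thresholdRequest q t) := by
        refine (Finset.sum_filter_of_ne fun t _ ht => ?_).symm
        rcases h : thresholdRequest q t with _ | a
        · simp [h, requestWeight] at ht
        · rfl
    _ = ∑ t ∈ A, w (g t) := by
        refine Finset.sum_congr rfl fun t ht => ?_
        obtain ⟨i, -, hi⟩ := thresholdRequest_eq_some_iff.1 (hAg t ht)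
        rw [firstExceeds, Bool.and_eq_true] at hi
        have hlt := ((exceeds_iff h0).1 hi.1).trans_le (le_of_tendsto_approx h1 hlim _ _)
        rw [hAg t ht]
        simp only [hw, if_pos hlt]
        rfl
    _ = ∑ z ∈ A.image g, w z := (Finset.sum_image hinj).symm
    _ ≤ ∑ z ∈ F ×ˢ Finset.range T, w z := by
        refine Finset.sum_le_sum_of_subset_of_nonneg ?_ fun z _ _ => hw0 z
        intro z hz
        obtain ⟨t, ht, rfl⟩ := Finset.mem_image.1 hz
        rw [Finset.mem_product, Finset.mem_range]
        exact ⟨Finset.mem_image_of_mem _ ht, (snd_le_of_thresholdRequest t _ (hAg t ht)).trans_lt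
          (Finset.mem_range.1 (Finset.mem_filter.1 ht).1)⟩
    _ = ∑ x ∈ F, ∑ k ∈ Finset.range T, w (x, k) := Finset.sum_product _ _ _
    _ ≤ ∑ x ∈ F, m x := Finset.sum_le_sum fun x _ => sum_half_pow_le (hm0 x) T
    _ ≤ 1 := hsum F

end Upper

/-- Every lower semicomputable semimeasure `m` has a prefix decompressor giving each `x` a
codeword of length `-log₂ (m x) + O(1)`. -/
theorem LscSemimeasure.exists_prefixFn {m : List Bool → ℝ} (hm : LscSemimeasure m) :
    ∃ D : List Bool →. List Bool, Partrec D ∧ PrefixFn D ∧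
      ∀ x, 0 < m x → ∃ p : List Bool, x ∈ D p ∧ (p.length : ℝ) ≤ -Real.logb 2 (m x) + 3 := by
  obtain ⟨-, hsum, q, hq, h0, h1, hlim⟩ := hm
  obtain ⟨D, hD, hpre, hserve⟩ := exists_prefixFn_of_requests snd_le_of_thresholdRequest
    (Computable.thresholdRequest hq) (sum_thresholdRequest_le h0 h1 hlim hsum)
  refine ⟨D, hD, hpre, fun x hx => ?_⟩
  have hx1 : m x ≤ 1 := by simpa using hsum {x}
  obtain ⟨k, hk, hk'⟩ : ∃ k : ℕ, (1 / 2 : ℝ) ^ k < m x ∧ m x ≤ 2 * (1 / 2) ^ k := by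
    have hex : ∃ k : ℕ, (1 / 2 : ℝ) ^ k < m x := exists_pow_lt_of_lt_one hx (by norm_num)
    classical
    refine ⟨Nat.find hex, Nat.find_spec hex, ?_⟩
    rcases hz : Nat.find hex with _ | j
    · norm_num; linarith
    · have := Nat.find_min hex (m := j) (by omega)
      rw [pow_succ]
      linarith
  obtain ⟨n, hn⟩ := ((hlim x).eventually (lt_mem_nhds hk)).exists
  obtain ⟨i, hi⟩ := exists_firstExceeds h0 hn
  obtain ⟨p, hp, hlen⟩ := hserve _ x k (thresholdRequest_eq_some_iff.2 ⟨i, rfl, hi⟩)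
  refine ⟨p, hp, ?_⟩
  have hlog := Real.logb_le_logb_of_le one_lt_two hx hk'
  rw [Real.logb_mul two_ne_zero (by positivity), Real.logb_self_eq_one one_lt_two, Real.logb_pow,
    one_div, Real.logb_inv, Real.logb_self_eq_one one_lt_two] at hlog
  rw [hlen]
  push_cast
  linarith

/-- The Kraft inequality for the domain of a prefix function. -/
theorem PrefixFn.sum_half_pow_length_le {U : List Bool →. List Bool} (hU : PrefixFn U)
    (S : Finset (List Bool)) (hS : ∀ p ∈ S, (U p).Dom) :
    ∑ p ∈ S, (1 / 2 : ℝ) ^ p.length ≤ 1 := by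
  have hpre {p q : List Bool} (hp : p ∈ S) (hq : q ∈ S) (h : p <+: q) : p = q := by
    by_contra hne
    exact hU p q h hne (hS p hp) (hS q hq)
  by_cases hnil : [] ∈ S
  · have hsub : S ⊆ {[]} := fun q hq => by
      rw [Finset.mem_singleton, hpre hnil hq ⟨q, rfl⟩]
    calc _ ≤ ∑ p ∈ ({[]} : Finset (List Bool)), (1 / 2 : ℝ) ^ p.length :=
          Finset.sum_le_sum_of_subset_of_nonneg hsub fun _ _ _ => by positivity
      _ ≤ 1 := by simp
  · have hud : InformationTheory.UniquelyDecodable (S : Set (List Bool)) := by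
      intro L
      induction L with
      | nil =>
        rintro (_ | ⟨q, L'⟩) - h2 h
        · rfl
        · have : q = [] := by simp at h; exact h.1
          exact absurd (h2 q List.mem_cons_self) (this ▸ hnil)
      | cons p L ih =>
        rintro (_ | ⟨q, L'⟩) h1 h2 h
        · have : p = [] := by simp at h; exact h.1
          exact absurd (h1 p List.mem_cons_self) (this ▸ hnil)
        · rw [List.flatten_cons, List.flatten_cons] at h
          have hp := h1 p List.mem_cons_self
          have hq := h2 q List.mem_cons_self
          have hpq : p = q := by
            rcases List.append_eq_append_iff.1 h with ⟨w, hw, -⟩ | ⟨w, hw, -⟩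
            · exact hpre hp hq ⟨w, hw.symm⟩
            · exact (hpre hq hp ⟨w, hw.symm⟩).symm
          subst hpq
          rw [ih L' (fun w hw => h1 w (List.mem_cons_of_mem _ hw))
            (fun w hw => h2 w (List.mem_cons_of_mem _ hw)) (List.append_cancel_left h)]
    simpa using InformationTheory.kraft_mcmillan_inequality hud

section Lower

open Nat.Partrec (Code)

/-- The contribution to the `n`-th approximation at `x`, scaled by `2 ^ n`, of the program
with code `i`. -/
def outputWeight (c : Code) (v : (List Bool × ℕ) × ℕ) : ℕ :=
  bif decide (c.evaln v.1.2 v.2 = some (encode v.1.1)) then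
    (decode₂ (List Bool) v.2).elim 0 fun p => 2 ^ (v.1.2 - p.length)
  else 0

/-- The total weight, scaled by `2 ^ n`, of the programs found to output `x` within `n` steps,
where `v = (x, n)`. -/
def outputWeightSum (c : Code) (v : List Bool × ℕ) : ℕ :=
  Nat.rec 0 (fun i y => y + outputWeight c (v, i)) v.2

/-- The probability that a random program outputs `x` within `n` steps, where `v = (x, n)`. -/
def outputProb (c : Code) (v : List Bool × ℕ) : ℚ :=
  outputWeightSum c v / (2 ^ v.2 : ℕ)

/-- The probability of the program with code `i`. -/
noncomputable def programWeight (i : ℕ) : ℝ :=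
  (decode₂ (List Bool) i).elim 0 fun p => (1 / 2) ^ p.length

theorem programWeight_nonneg (i : ℕ) : 0 ≤ programWeight i := by
  rw [programWeight]
  cases decode₂ (List Bool) i <;> simp

theorem programWeight_encode (p : List Bool) : programWeight (encode p) = (1 / 2) ^ p.length := by
  simp [programWeight]

theorem Primrec.outputWeight (c : Code) : Primrec (outputWeight c) := by
  have hn : Primrec fun v : (List Bool × ℕ) × ℕ => v.1.2 := Primrec.snd.comp Primrec.fst
  have hev : Primrec fun v : (List Bool × ℕ) × ℕ => c.evaln v.1.2 v.2 :=
    Code.primrec_evaln.comp ((hn.pair (Primrec.const c)).pair Primrec.snd)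
  have hx : Primrec fun v : (List Bool × ℕ) × ℕ => some (encode v.1.1) :=
    Primrec.option_some.comp (Primrec.encode.comp (Primrec.fst.comp Primrec.fst))
  have hc : Primrec fun v : (List Bool × ℕ) × ℕ =>
      decide (c.evaln v.1.2 v.2 = some (encode v.1.1)) :=
    PrimrecPred.decide (Primrec.eq.comp hev hx)
  have hd : Primrec fun v : (List Bool × ℕ) × ℕ => decode₂ (List Bool) v.2 :=
    Primrec.decode₂.comp Primrec.snd
  have hp : Primrec₂ fun (v : (List Bool × ℕ) × ℕ) (p : List Bool) => 2 ^ (v.1.2 - p.length) :=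
    Primrec.two_pow.comp (Primrec.nat_sub.comp (hn.comp Primrec.fst)
      (Primrec.list_length.comp Primrec.snd))
  have he : Primrec fun v : (List Bool × ℕ) × ℕ =>
      (decode₂ (List Bool) v.2).elim 0 fun p => 2 ^ (v.1.2 - p.length) :=
    (Primrec.option_casesOn hd (Primrec.const 0) hp).of_eq fun v => by
      cases decode₂ (List Bool) v.2 <;> rfl
  exact Primrec.cond hc he (Primrec.const 0)

theorem Primrec.outputWeightSum (c : Code) : Primrec (outputWeightSum c) := by
  have hs : Primrec₂ fun (v : List Bool × ℕ) (z : ℕ × ℕ) =>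
      z.2 + _root_.outputWeight c (v, z.1) :=
    Primrec.nat_add.comp (Primrec.snd.comp Primrec.snd)
      ((Primrec.outputWeight c).comp (Primrec.fst.pair (Primrec.fst.comp Primrec.snd)))
  exact Primrec.nat_rec' Primrec.snd (Primrec.const 0) hs

theorem Computable.outputProb (c : Code) : Computable (outputProb c) :=
  Computable.rat_natCast_div (Primrec.outputWeightSum c).to_comp
    (Primrec.two_pow.to_comp.comp .snd) fun _ => by positivity

theorem outputWeight_div_two_pow (c : Code) (x : List Bool) (n i : ℕ) :
    (outputWeight c ((x, n), i) : ℝ) / 2 ^ n =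
      if c.evaln n i = some (encode x) then programWeight i else 0 := by
  rw [outputWeight, programWeight]
  split_ifs with h
  · have hin : i < n := Code.evaln_bound h
    rw [decide_eq_true h, cond_true]
    rcases hp : decode₂ (List Bool) i with _ | p
    · simp
    · have hle : p.length ≤ n :=
        (length_le_encode p).trans ((mem_decode₂.1 hp).le.trans hin.le)
      obtain ⟨d, rfl⟩ := Nat.exists_eq_add_of_le hle
      simp [pow_add]
      field_simp
  · simp [h]

theorem outputProb_eq_sum (c : Code) (x : List Bool) (n : ℕ) :
    (outputProb c (x, n) : ℝ) =
      ∑ i ∈ Finset.range n, if c.evaln n i = some (encode x) then programWeight i else 0 := by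
  have hsum (N : ℕ) : (Nat.rec 0 (fun i y => y + outputWeight c ((x, n), i)) N : ℕ) =
      ∑ i ∈ Finset.range N, outputWeight c ((x, n), i) := by
    induction N with
    | zero => rfl
    | succ N ih => rw [Finset.sum_range_succ, ← ih]
  simp only [← outputWeight_div_two_pow, ← Finset.sum_div]
  rw [outputProb, outputWeightSum, hsum]
  push_cast
  rfl

theorem outputProb_nonneg (c : Code) (x : List Bool) (n : ℕ) : 0 ≤ outputProb c (x, n) := by
  rw [outputProb]
  positivity

theorem outputProb_mono (c : Code) (x : List Bool) : Monotone fun n => outputProb c (x, n) := by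
  intro a b hab
  rw [← Rat.cast_le (K := ℝ), outputProb_eq_sum, outputProb_eq_sum]
  have h0 (n i : ℕ) : 0 ≤ if c.evaln n i = some (encode x) then programWeight i else 0 := by
    split_ifs
    · exact programWeight_nonneg i
    · exact le_rfl
  calc _ ≤ ∑ i ∈ Finset.range a, if c.evaln b i = some (encode x) then programWeight i else 0 := by
        refine Finset.sum_le_sum fun i _ => ?_
        by_cases h : c.evaln a i = some (encode x)
        · rw [if_pos h, if_pos (Option.mem_def.1 (Code.evaln_mono hab h))]
        · rw [if_neg h]
          exact h0 b i
    _ ≤ _ := Finset.sum_le_sum_of_subset_of_nonneg (Finset.range_subset_range.2 hab)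
        fun i _ _ => h0 b i

variable {U : List Bool →. List Bool} {c : Code}
  (hc : c.eval = fun n => Part.bind (decode₂ (List Bool) n) fun p => (U p).map encode)
include hc

theorem eval_encode_program (p : List Bool) : c.eval (encode p) = (U p).map encode := by
  simp [hc]

theorem sum_outputProb_le (hU : PrefixFn U) (n : ℕ) (F : Finset (List Bool)) :
    ∑ x ∈ F, (outputProb c (x, n) : ℝ) ≤ 1 := by
  classical
  simp only [outputProb_eq_sum]
  rw [Finset.sum_comm]
  calc _ ≤ ∑ i ∈ Finset.range n, if (c.eval i).Dom then programWeight i else 0 := by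
        refine Finset.sum_le_sum fun i _ => ?_
        rcases h : c.evaln n i with _ | y
        · simp only [reduceCtorEq, if_false, Finset.sum_const_zero]
          split_ifs
          · exact programWeight_nonneg i
          · exact le_rfl
        · rw [if_pos (Part.dom_iff_mem.2 ⟨y, Code.evaln_sound h⟩), ← Finset.sum_filter,
            Finset.sum_const, nsmul_eq_mul]
          refine mul_le_of_le_one_left (programWeight_nonneg i) ?_
          norm_cast
          refine Finset.card_le_one.2 fun a ha b hb =>
            encode_injective (α := List Bool) ?_
          have ha := (Finset.mem_filter.1 ha).2
          have hb := (Finset.mem_filter.1 hb).2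
          exact Option.some_injective _ (ha.symm.trans hb)
    _ = ∑ p ∈ (Finset.range n).preimage (encode (α := List Bool)) encode_injective.injOn,
          if (c.eval (encode p)).Dom then programWeight (encode p) else 0 := by
        refine (Finset.sum_preimage encode _ encode_injective.injOn _ fun i _ hi => ?_).symm
        have : decode₂ (List Bool) i = none := by
          by_contra h
          exact hi (decode₂_ne_none_iff.1 h)
        simp [programWeight, this]
    _ = ∑ p ∈ ((Finset.range n).preimage encode encode_injective.injOn).filter
          fun p => (U p).Dom, (1 / 2 : ℝ) ^ p.length := by
        rw [Finset.sum_filter]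
        refine Finset.sum_congr rfl fun p _ => ?_
        rw [eval_encode_program hc, programWeight_encode]
        rfl
    _ ≤ 1 := hU.sum_half_pow_length_le _ fun p hp => (Finset.mem_filter.1 hp).2

theorem exists_half_pow_le_outputProb {p x : List Bool} (hx : x ∈ U p) :
    ∃ n, (1 / 2 : ℝ) ^ p.length ≤ outputProb c (x, n) := by
  have he : encode x ∈ c.eval (encode p) := by
    rw [eval_encode_program hc]
    exact Part.mem_map encode hx
  obtain ⟨n, hn⟩ := Code.evaln_complete.1 he
  refine ⟨n, ?_⟩
  rw [outputProb_eq_sum, ← programWeight_encode]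
  have h := Finset.single_le_sum
    (f := fun i => if c.evaln n i = some (encode x) then programWeight i else 0)
    (fun i _ => by
      split_ifs
      · exact programWeight_nonneg i
      · exact le_rfl)
    (Finset.mem_range.2 (Code.evaln_bound hn))
  simpa only [if_pos (Option.mem_def.1 hn)] using h

end Lower

/-- A limit of an increasing computable sequence of subprobabilities is a lower semicomputable
semimeasure. -/
theorem exists_lscSemimeasure_of_mono {q : List Bool × ℕ → ℚ} (hq : Computable q)
    (h0 : ∀ x n, 0 ≤ q (x, n)) (hmono : ∀ x, Monotone fun n => q (x, n))
    (hsum : ∀ (n : ℕ) (F : Finset (List Bool)), ∑ x ∈ F, (q (x, n) : ℝ) ≤ 1) :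
    ∃ m, LscSemimeasure m ∧ ∀ x n, (q (x, n) : ℝ) ≤ m x := by
  have hbdd (x) : BddAbove (Set.range fun n => (q (x, n) : ℝ)) :=
    ⟨1, by rintro _ ⟨n, rfl⟩; simpa using hsum n {x}⟩
  have hle (x n) : (q (x, n) : ℝ) ≤ ⨆ n, (q (x, n) : ℝ) := le_ciSup (hbdd x) n
  have hlim (x) : Tendsto (fun n => (q (x, n) : ℝ)) atTop (nhds (⨆ n, (q (x, n) : ℝ))) :=
    tendsto_atTop_ciSup (fun a b hab => by exact_mod_cast hmono x hab) (hbdd x)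
  refine ⟨fun x => ⨆ n, (q (x, n) : ℝ), ⟨fun x => ?_, fun F => ?_, q, hq, h0,
    fun x n => hmono x n.le_succ, hlim⟩, hle⟩
  · exact le_trans (by exact_mod_cast h0 x 0) (hle x 0)
  · exact le_of_tendsto' (tendsto_finsetSum F fun x _ => hlim x) fun n => hsum n F

theorem PrefixFn.exists_lscSemimeasure {U : List Bool →. List Bool} (hU : PrefixFn U)
    (hpart : Partrec U) :
    ∃ m, LscSemimeasure m ∧ ∀ p x, x ∈ U p → (1 / 2 : ℝ) ^ p.length ≤ m x := by
  obtain ⟨c, hc⟩ := Nat.Partrec.Code.exists_code.1 (Partrec.bind_decode₂_iff.1 hpart)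
  obtain ⟨m, hm, hle⟩ := exists_lscSemimeasure_of_mono (Computable.outputProb c)
    (outputProb_nonneg c) (outputProb_mono c) (sum_outputProb_le hc hU)
  refine ⟨m, hm, fun p x hx => ?_⟩
  obtain ⟨n, hn⟩ := exists_half_pow_le_outputProb hc hx
  exact hn.trans (hle x n)

theorem exists_lscSemimeasure_pos : ∃ m, LscSemimeasure m ∧ ∀ x, 0 < m x := by
  have hq : Computable fun v : List Bool × ℕ => ((1 : ℕ) / (2 ^ (encode v.1 + 1) : ℕ) : ℚ) :=
    Computable.rat_natCast_div (Computable.const 1) (Primrec.two_pow.comp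
      (Primrec.succ.comp (Primrec.encode.comp Primrec.fst))).to_comp fun _ => by positivity
  obtain ⟨m, hm, hle⟩ := exists_lscSemimeasure_of_mono hq (fun x n => by positivity)
    (fun x _ _ _ => le_rfl) fun n F => by
      have hgeom : ∑' i : ℕ, (1 / 2 : ℝ) ^ (i + 1) = 1 := by
        simp only [pow_succ]
        rw [tsum_mul_right, tsum_geometric_two]
        norm_num
      have hs : Summable fun i : ℕ => (1 / 2 : ℝ) ^ (i + 1) :=
        (summable_nat_add_iff 1).2 summable_geometric_two
      rw [← hgeom]
      calc _ = ∑ x ∈ F, (1 / 2 : ℝ) ^ (encode x + 1) := by simp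
        _ = ∑ i ∈ F.map ⟨encode, encode_injective⟩, (1 / 2 : ℝ) ^ (i + 1) := by
          rw [Finset.sum_map]; rfl
        _ ≤ _ := hs.sum_le_tsum _ fun i _ => by positivity
  exact ⟨m, hm, fun x => lt_of_lt_of_le (by positivity) (hle x 0)⟩

theorem exists_length_eq_Kc {D : List Bool →. List Bool} {x : List Bool} (h : Kc D x ≠ ⊤) :
    ∃ p, x ∈ D p ∧ (p.length : ℕ∞) = Kc D x := by
  refine csInf_mem (s := {n : ℕ∞ | ∃ p : List Bool, x ∈ D p ∧ (p.length : ℕ∞) = n}) ?_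
  rw [Set.nonempty_iff_ne_empty]
  intro h0
  exact h (by rw [Kc, h0, sInf_empty])

end Auxiliary

/-- Coding theorem: for a maximal lower semicomputable semimeasure `m`,
`m(x) > 0` everywhere and `KP(x) = −log₂ m(x) + O(1)`. (`KP(x)` is everywhere
finite; it is taken as a natural number via `ENat.toNat`.) -/
theorem coding_theorem
    (U : List Bool →. List Bool) (hU : OptimalPrefixDecompressor U)
    (m : List Bool → ℝ) (hm : LscSemimeasure m)
    (hmax : ∀ m' : List Bool → ℝ, LscSemimeasure m' →
      ∃ c : ℝ, 0 < c ∧ ∀ x, m' x ≤ c * m x) :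
    (∀ x : List Bool, 0 < m x) ∧
    ∃ c : ℝ, ∀ x : List Bool,
      Kc U x ≠ ⊤ ∧
      (((Kc U x).toNat : ℝ) ≤ -Real.logb 2 (m x) + c) ∧
      (-Real.logb 2 (m x) ≤ ((Kc U x).toNat : ℝ) + c) := by
  have hpos : ∀ x, 0 < m x := by
    obtain ⟨m', hm', hpos⟩ := exists_lscSemimeasure_pos
    obtain ⟨c, hc, hle⟩ := hmax m' hm'
    exact fun x => pos_of_mul_pos_right ((hpos x).trans_le (hle x)) hc.le
  refine ⟨hpos, ?_⟩
  obtain ⟨hpart, hpre, hopt⟩ := hU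
  obtain ⟨D, hD, hDpre, hDlen⟩ := hm.exists_prefixFn
  obtain ⟨c₁, hc₁⟩ := hopt D hD hDpre
  obtain ⟨m', hm', hlow⟩ := hpre.exists_lscSemimeasure hpart
  obtain ⟨c₂, hc₂, hle⟩ := hmax m' hm'
  refine ⟨max (3 + c₁) (Real.logb 2 c₂), fun x => ?_⟩
  obtain ⟨p, hp, hlen⟩ := hDlen x (hpos x)
  have hKD : Kc D x ≤ p.length := sInf_le ⟨p, hp, rfl⟩
  have hKU : Kc U x ≤ ((p.length + c₁ : ℕ) : ℕ∞) := by
    push_cast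
    exact (hc₁ x).trans (by gcongr)
  have htop : Kc U x ≠ ⊤ := ne_top_of_le_ne_top (ENat.natCast_ne_top _) hKU
  refine ⟨htop, ?_, ?_⟩
  · have h : (Kc U x).toNat ≤ p.length + c₁ := ENat.toNat_le_of_le_natCast hKU
    have h' : ((Kc U x).toNat : ℝ) ≤ p.length + c₁ := by exact_mod_cast h
    have := le_max_left (3 + c₁ : ℝ) (Real.logb 2 c₂)
    linarith
  · obtain ⟨r, hr, hrlen⟩ := exists_length_eq_Kc htop
    rw [← hrlen, ENat.toNat_natCast]
    have h := Real.logb_le_logb_of_le one_lt_two (by positivity) ((hlow r x hr).trans (hle x))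
    rw [Real.logb_mul hc₂.ne' (hpos x).ne', Real.logb_pow, one_div, Real.logb_inv,
      Real.logb_self_eq_one one_lt_two] at h
    have := le_max_right (3 + c₁ : ℝ) (Real.logb 2 c₂)
    linarith
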